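/- Let n ≥ 2, μ > 0, T > 0 and δ > 0. Suppose u : ℝⁿ × [0,T] → ℝ is continuous, the derivatives ∂_t u, ∂_i u and ∂_i∂_j u (i,j = 1,…,n) exist and are continuous on ℝⁿ × [0,T], and there is M ≥ 0 such that for all (x,t): |u(x,t)| ≤ M w(x)^{−δ}, |∂_i u(x,t)| ≤ M w(x)^{−δ−1}, |∂_i∂_j u(x,t)| ≤ M w(x)^{−δ−2} and |∂_t u(x,t)| ≤ M w(x)^{−δ}. Then the Green-type representation u(x,t) = ∫₀^t ∫_{ℝⁿ} ψ_μ(x−y, t−s) (∂_t u − μΔu)(y,s) dy ds + ∫_{ℝⁿ} ψ_μ(x−y, t) u(y,0) dy holds for all (x,t) ∈ ℝⁿ × (0,T]. -/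

import Mathlib

open MeasureTheory

/-- The weight `w(x) = √(1+|x|²)`. -/
noncomputable def wgt {n : ℕ} (x : EuclideanSpace ℝ (Fin n)) : ℝ := Real.sqrt (1 + ‖x‖ ^ 2)

/-- The standard heat kernel `ψ_μ(x,t) = (4πμt)^{−n/2} exp(−|x|²/(4μt))` on `ℝⁿ` (for `t > 0`). -/
noncomputable def heatK (n : ℕ) (μ : ℝ) (x : EuclideanSpace ℝ (Fin n)) (t : ℝ) : ℝ :=
  (4 * Real.pi * μ * t) ^ (-(n : ℝ) / 2) * Real.exp (-‖x‖ ^ 2 / (4 * μ * t))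

/-- Spatial partial derivative in the `i`-th coordinate direction of a time-dependent scalar
field `u(x,t)` on `ℝⁿ × ℝ`. -/
noncomputable def pdx {n : ℕ} (i : Fin n) (f : EuclideanSpace ℝ (Fin n) → ℝ → ℝ) :
    EuclideanSpace ℝ (Fin n) → ℝ → ℝ :=
  fun x t => fderiv ℝ (fun y => f y t) x (EuclideanSpace.single i 1)

theorem integrable_exp_neg_mul_sq_norm {n : ℕ} {b : ℝ} (hb : 0 < b) :
    Integrable (fun x : EuclideanSpace ℝ (Fin n) => Real.exp (-b * ‖x‖ ^ 2)) := by
  by_contra h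
  have h0 := integral_undef h
  rw [GaussianFourier.integral_rexp_neg_mul_sq_norm hb] at h0
  have : 0 < (Real.pi / b) ^ (Module.finrank ℝ (EuclideanSpace ℝ (Fin n)) / 2 : ℝ) := by
    positivity
  exact this.ne' h0

theorem heatK_nonneg {n : ℕ} {μ t : ℝ} (hμ : 0 < μ) (ht : 0 < t)
    (x : EuclideanSpace ℝ (Fin n)) : 0 ≤ heatK n μ x t := by
  unfold heatK; positivity

theorem heatK_one {n : ℕ} (μ : ℝ) (x : EuclideanSpace ℝ (Fin n)) :
    heatK n μ x 1 = (4 * Real.pi * μ) ^ (-(n : ℝ) / 2) * Real.exp (-(1 / (4 * μ)) * ‖x‖ ^ 2) := by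
  unfold heatK
  rw [mul_one, mul_one]
  congr 2
  ring

theorem continuous_heatK_one (n : ℕ) (μ : ℝ) :
    Continuous fun x : EuclideanSpace ℝ (Fin n) => heatK n μ x 1 := by
  simp only [heatK_one]
  fun_prop

theorem integrable_heatK_one (n : ℕ) {μ : ℝ} (hμ : 0 < μ) :
    Integrable fun x : EuclideanSpace ℝ (Fin n) => heatK n μ x 1 := by
  simp only [heatK_one]
  exact (integrable_exp_neg_mul_sq_norm (by positivity)).const_mul _

theorem integral_heatK_one (n : ℕ) {μ : ℝ} (hμ : 0 < μ) :
    ∫ x : EuclideanSpace ℝ (Fin n), heatK n μ x 1 = 1 := by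
  simp only [heatK_one]
  rw [integral_const_mul, GaussianFourier.integral_rexp_neg_mul_sq_norm (by positivity)]
  have h : Real.pi / (1 / (4 * μ)) = 4 * Real.pi * μ := by field_simp
  rw [h, finrank_euclideanSpace_fin, ← Real.rpow_add (by positivity)]
  ring_nf
  simp

theorem integrable_heatK_one_mul_norm (n : ℕ) {μ : ℝ} (hμ : 0 < μ) :
    Integrable fun x : EuclideanSpace ℝ (Fin n) => heatK n μ x 1 * ‖x‖ := by
  simp only [heatK_one, mul_assoc]
  refine Integrable.const_mul ?_ _
  have hc : 0 < 1 / (8 * μ) := by positivity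
  refine ((integrable_exp_neg_mul_sq_norm (n := n) hc).const_mul (1 + 8 * μ)).mono'
    (by fun_prop) (.of_forall fun x => ?_)
  rw [Real.norm_of_nonneg (by positivity)]
  have h1 : Real.exp (-(1 / (4 * μ)) * ‖x‖ ^ 2)
      = Real.exp (-(1 / (8 * μ)) * ‖x‖ ^ 2) * Real.exp (-(1 / (8 * μ) * ‖x‖ ^ 2)) := by
    rw [← Real.exp_add]
    congr 1
    field_simp
    ring
  have h2 : ‖x‖ * Real.exp (-(1 / (8 * μ) * ‖x‖ ^ 2)) ≤ 1 + 8 * μ := by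
    rw [Real.exp_neg, ← div_eq_mul_inv, div_le_iff₀ (Real.exp_pos _)]
    have h3 := Real.add_one_le_exp (1 / (8 * μ) * ‖x‖ ^ 2)
    have h4 : (1 + 8 * μ) * (1 / (8 * μ) * ‖x‖ ^ 2 + 1)
        = ‖x‖ ^ 2 + 1 + 8 * μ + 1 / (8 * μ) * ‖x‖ ^ 2 := by
      field_simp
      ring
    have h5 : 0 ≤ 1 / (8 * μ) * ‖x‖ ^ 2 := by positivity
    have h6 : (1 + 8 * μ) * (1 / (8 * μ) * ‖x‖ ^ 2 + 1)
        ≤ (1 + 8 * μ) * Real.exp (1 / (8 * μ) * ‖x‖ ^ 2) := by gcongr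
    nlinarith [sq_nonneg (‖x‖ - 1)]
  rw [h1]
  calc _ = Real.exp (-(1 / (8 * μ)) * ‖x‖ ^ 2)
        * (‖x‖ * Real.exp (-(1 / (8 * μ) * ‖x‖ ^ 2))) := by ring
    _ ≤ Real.exp (-(1 / (8 * μ)) * ‖x‖ ^ 2) * (1 + 8 * μ) := by gcongr
    _ = _ := by ring

/-- Parabolic rescaling of a convolution with the heat kernel. -/
theorem integral_heatK_sub_mul {n : ℕ} {μ τ : ℝ} (hμ : 0 < μ) (hτ : 0 < τ)
    (f : EuclideanSpace ℝ (Fin n) → ℝ) (x : EuclideanSpace ℝ (Fin n)) :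
    ∫ y, heatK n μ (x - y) τ * f y = ∫ z, heatK n μ z 1 * f (x - Real.sqrt τ • z) := by
  have hr : 0 < Real.sqrt τ := Real.sqrt_pos.2 hτ
  have key : ∀ z : EuclideanSpace ℝ (Fin n),
      heatK n μ z 1 = Real.sqrt τ ^ n * heatK n μ (Real.sqrt τ • z) τ := by
    intro z
    unfold heatK
    have h1 : ‖Real.sqrt τ • z‖ ^ 2 = τ * ‖z‖ ^ 2 := by
      rw [norm_smul, mul_pow, Real.norm_of_nonneg hr.le, Real.sq_sqrt hτ.le]
    have h2 : τ ^ (-(n : ℝ) / 2) = (Real.sqrt τ ^ n)⁻¹ := by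
      rw [Real.sqrt_eq_rpow, ← Real.rpow_natCast, ← Real.rpow_mul hτ.le, ← Real.rpow_neg hτ.le]
      congr 1
      ring
    rw [h1, Real.mul_rpow (by positivity) hτ.le, h2, mul_one, mul_one]
    have h3 : -(τ * ‖z‖ ^ 2) / (4 * μ * τ) = -‖z‖ ^ 2 / (4 * μ) := by field_simp
    rw [h3]
    field_simp
  have h := Measure.integral_comp_smul (volume : Measure (EuclideanSpace ℝ (Fin n)))
    (fun y => heatK n μ y τ * f (x - y)) (Real.sqrt τ)
  rw [finrank_euclideanSpace_fin, abs_of_pos (by positivity), smul_eq_mul] at h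
  have h' : ∫ y, heatK n μ (x - y) τ * f y = ∫ y, heatK n μ y τ * f (x - y) := by
    rw [← integral_sub_left_eq_self (fun y => heatK n μ y τ * f (x - y)) volume x]
    simp
  simp only [key, mul_assoc]
  rw [integral_const_mul, h, h']
  field_simp

theorem hasFDerivAt_heatK_one {n : ℕ} (μ : ℝ) (x : EuclideanSpace ℝ (Fin n)) :
    HasFDerivAt (fun z => heatK n μ z 1)
      ((-(1 / (2 * μ)) * heatK n μ x 1) • innerSL ℝ x) x := by
  simp only [heatK_one]
  have h := ((((hasStrictFDerivAt_norm_sq x).hasFDerivAt).const_mul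
    (-(1 / (4 * μ)))).exp).const_mul ((4 * Real.pi * μ) ^ (-(n : ℝ) / 2))
  refine h.congr_fderiv ?_
  ext v
  simp only [smul_apply, smul_eq_mul, innerSL_apply_apply]
  ring_nf

/-- Gaussian integration by parts in the `i`-th coordinate. -/
theorem integral_heatK_one_mul_coord_mul {n : ℕ} {μ C : ℝ} (hμ : 0 < μ) (i : Fin n)
    {g : EuclideanSpace ℝ (Fin n) → ℝ} (hg : Differentiable ℝ g)
    (hg' : Continuous fun y => fderiv ℝ g y (EuclideanSpace.single i 1))
    (hb : ∀ y, |g y| ≤ C) (hb' : ∀ y, |fderiv ℝ g y (EuclideanSpace.single i 1)| ≤ C)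
    (x : EuclideanSpace ℝ (Fin n)) (r : ℝ) :
    ∫ z, heatK n μ z 1 * (z i * g (x - r • z))
      = -(2 * μ * r) * ∫ z, heatK n μ z 1
          * fderiv ℝ g (x - r • z) (EuclideanSpace.single i 1) := by
  have hcont := continuous_heatK_one n μ
  have hi : ∀ z : EuclideanSpace ℝ (Fin n), HasFDerivAt (fun z => g (x - r • z))
      (-(r • fderiv ℝ g (x - r • z))) z := by
    intro z
    have h1 : HasFDerivAt (fun z : EuclideanSpace ℝ (Fin n) => x - r • z)
        (-(r • ContinuousLinearMap.id ℝ (EuclideanSpace ℝ (Fin n)))) z :=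
      ((hasFDerivAt_id z).const_smul r).const_sub x
    have h2 := (hg (x - r • z)).hasFDerivAt.comp z h1
    refine HasFDerivAt.congr_fderiv (f := fun z => g (x - r • z)) h2 ?_
    ext v
    simp
  have e1 : ∀ z, fderiv ℝ (fun z => heatK n μ z 1) z (EuclideanSpace.single i 1)
      = -(1 / (2 * μ)) * (heatK n μ z 1 * z i) := by
    intro z
    rw [(hasFDerivAt_heatK_one μ z).fderiv]
    simp [EuclideanSpace.inner_single_right]
    ring
  have e2 : ∀ z, fderiv ℝ (fun z => g (x - r • z)) z (EuclideanSpace.single i 1)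
      = -(r * fderiv ℝ g (x - r • z) (EuclideanSpace.single i 1)) := by
    intro z
    rw [(hi z).fderiv]
    simp
  have hcoord : Integrable fun z : EuclideanSpace ℝ (Fin n) => heatK n μ z 1 * z i := by
    refine (integrable_heatK_one_mul_norm n hμ).mono' (by fun_prop) (.of_forall fun z => ?_)
    rw [norm_mul, Real.norm_of_nonneg (heatK_nonneg hμ one_pos z)]
    exact mul_le_mul_of_nonneg_left (PiLp.norm_apply_le z i) (heatK_nonneg hμ one_pos z)
  have hgc : Continuous g := hg.continuous
  have h := integral_mul_fderiv_eq_neg_fderiv_mul_of_integrable (μ := volume)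
    (f := fun z => heatK n μ z 1) (g := fun z => g (x - r • z))
    (v := EuclideanSpace.single i (1 : ℝ)) ?_ ?_ ?_
    (fun z _ => (hasFDerivAt_heatK_one μ z).differentiableAt)
    (fun z _ => (hi z).differentiableAt)
  · simp only [e1, e2] at h
    have l : ∀ z : EuclideanSpace ℝ (Fin n),
        heatK n μ z 1 * -(r * fderiv ℝ g (x - r • z) (EuclideanSpace.single i 1))
        = -r * (heatK n μ z 1 * fderiv ℝ g (x - r • z) (EuclideanSpace.single i 1)) :=
      fun z => by ring
    have l' : ∀ z : EuclideanSpace ℝ (Fin n),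
        -(1 / (2 * μ)) * (heatK n μ z 1 * z i) * g (x - r • z)
        = -(1 / (2 * μ)) * (heatK n μ z 1 * (z i * g (x - r • z))) := fun z => by ring
    simp only [l, l'] at h
    rw [integral_const_mul, integral_const_mul] at h
    generalize (∫ z, heatK n μ z 1 * (z i * g (x - r • z))) = A at h ⊢
    field_simp at h
    linarith
  · simp only [e1]
    exact (hcoord.const_mul _).mul_bdd (c := C) (by fun_prop) (.of_forall fun z => hb _)
  · simp only [e2]
    refine (integrable_heatK_one n hμ).mul_bdd (c := |r| * C) ?_ (.of_forall fun z => ?_)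
    · exact ((hg'.comp (by fun_prop : Continuous fun z : EuclideanSpace ℝ (Fin n) =>
        x - r • z)).const_mul r).neg.aestronglyMeasurable
    · rw [norm_neg, norm_mul]
      exact mul_le_mul_of_nonneg_left (hb' _) (abs_nonneg r)
  · exact (integrable_heatK_one n hμ).mul_bdd (c := C) (by fun_prop) (.of_forall fun z => hb _)

theorem apply_eq_sum_single {n : ℕ} (L : EuclideanSpace ℝ (Fin n) →L[ℝ] ℝ)
    (v : EuclideanSpace ℝ (Fin n)) : L v = ∑ i, v i * L (EuclideanSpace.single i 1) := by
  conv_lhs => rw [← (EuclideanSpace.basisFun (Fin n) ℝ).sum_repr v]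
  simp

section SpaceTime

variable {n : ℕ} {μ T C : ℝ} {u ut : EuclideanSpace ℝ (Fin n) → ℝ → ℝ}

theorem continuous_slice {f : EuclideanSpace ℝ (Fin n) → ℝ → ℝ}
    (hf : ContinuousOn (fun z : EuclideanSpace ℝ (Fin n) × ℝ => f z.1 z.2)
      (Set.univ ×ˢ Set.Icc (0 : ℝ) T)) {s : ℝ} (hs : s ∈ Set.Icc (0 : ℝ) T) :
    Continuous fun y => f y s :=
  hf.comp_continuous (f := fun y => (y, s)) (by fun_prop) fun _ => ⟨trivial, hs⟩

theorem continuousOn_integral_heatK_one_mul {f : EuclideanSpace ℝ (Fin n) → ℝ → ℝ} (hμ : 0 < μ)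
    (hf : ContinuousOn (fun z : EuclideanSpace ℝ (Fin n) × ℝ => f z.1 z.2)
      (Set.univ ×ˢ Set.Icc (0 : ℝ) T))
    (hb : ∀ y, ∀ s ∈ Set.Icc (0 : ℝ) T, |f y s| ≤ C) (x : EuclideanSpace ℝ (Fin n)) {t : ℝ}
    (ht : t ≤ T) :
    ContinuousOn (fun s => ∫ z, heatK n μ z 1 * f (x - Real.sqrt (t - s) • z) s)
      (Set.Icc 0 t) := by
  have hsub : Set.Icc 0 t ⊆ Set.Icc 0 T := Set.Icc_subset_Icc_right ht
  have hcont := continuous_heatK_one n μ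
  refine continuousOn_of_dominated (bound := fun z => heatK n μ z 1 * C)
    (fun s hs => ?_) (fun s hs => .of_forall fun z => ?_)
    ((integrable_heatK_one n hμ).mul_const C) (.of_forall fun z => ?_)
  · exact (hcont.mul ((continuous_slice hf (hsub hs)).comp (by fun_prop))).aestronglyMeasurable
  · rw [norm_mul, Real.norm_of_nonneg (heatK_nonneg hμ one_pos z)]
    exact mul_le_mul_of_nonneg_left (hb _ s (hsub hs)) (heatK_nonneg hμ one_pos z)
  · refine continuousOn_const.mul ?_
    exact hf.comp (f := fun s => (x - Real.sqrt (t - s) • z, s))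
      (Continuous.continuousOn (by fun_prop)) fun s hs => ⟨trivial, hsub hs⟩

theorem hasDerivAt_comp_sub_sqrt_smul
    (hcontt : ContinuousOn (fun z : EuclideanSpace ℝ (Fin n) × ℝ => ut z.1 z.2)
      (Set.univ ×ˢ Set.Icc (0 : ℝ) T))
    (hcont1 : ∀ i : Fin n,
      ContinuousOn (fun z : EuclideanSpace ℝ (Fin n) × ℝ => pdx i u z.1 z.2)
        (Set.univ ×ˢ Set.Icc (0 : ℝ) T))
    (hdt : ∀ (x : EuclideanSpace ℝ (Fin n)) (t : ℝ), t ∈ Set.Icc (0 : ℝ) T →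
      HasDerivWithinAt (u x) (ut x t) (Set.Icc (0 : ℝ) T) t)
    (hdiff1 : ∀ (x : EuclideanSpace ℝ (Fin n)) (t : ℝ), t ∈ Set.Icc (0 : ℝ) T →
      DifferentiableAt ℝ (fun y => u y t) x)
    (x z : EuclideanSpace ℝ (Fin n)) {s t : ℝ} (ht : t ≤ T) (hs : s ∈ Set.Ioo 0 t) :
    HasDerivAt (fun s => u (x - Real.sqrt (t - s) • z) s)
      (ut (x - Real.sqrt (t - s) • z) s
        + 1 / (2 * Real.sqrt (t - s)) * ∑ i, z i * pdx i u (x - Real.sqrt (t - s) • z) s) s := by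
  have hsT : s ∈ Set.Ioo 0 T := ⟨hs.1, hs.2.trans_le ht⟩
  have hnhds : ∀ y : EuclideanSpace ℝ (Fin n),
      Set.univ ×ˢ Set.Icc (0 : ℝ) T ∈ nhds ((y, s) : EuclideanSpace ℝ (Fin n) × ℝ) :=
    fun y => prod_mem_nhds Filter.univ_mem (Icc_mem_nhds hsT.1 hsT.2)
  have hev : ∀ y : EuclideanSpace ℝ (Fin n),
      ∀ᶠ v in nhds ((y, s) : EuclideanSpace ℝ (Fin n) × ℝ), v.2 ∈ Set.Ioo 0 T :=
    fun y => continuous_snd.continuousAt.eventually (Ioo_mem_nhds hsT.1 hsT.2)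
  set y := x - Real.sqrt (t - s) • z with hy
  have hu := hasStrictFDerivAt_uncurry_coprod (𝕜 := ℝ) (u := (y, s)) (f := u)
    (f₁ := fun y s => ∑ i, pdx i u y s • (EuclideanSpace.proj i :
      EuclideanSpace ℝ (Fin n) →L[ℝ] ℝ))
    (f₂ := fun y s => ContinuousLinearMap.toSpanSingleton ℝ (ut y s)) ?_ ?_ ?_ ?_
  · have hp : HasDerivAt (fun s => (x - Real.sqrt (t - s) • z, s))
        (-((-1 / (2 * Real.sqrt (t - s))) • z), (1 : ℝ)) s := by
      have h1 : HasDerivAt (fun s => Real.sqrt (t - s)) (-1 / (2 * Real.sqrt (t - s))) s :=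
        ((hasDerivAt_id s).const_sub t).sqrt (sub_pos.2 hs.2).ne'
      exact ((h1.smul_const z).const_sub x).prodMk (hasDerivAt_id s)
    have h := hu.hasFDerivAt.comp_hasDerivAt_of_eq s hp rfl
    refine HasDerivAt.congr_deriv (f := fun s => u (x - Real.sqrt (t - s) • z) s) h ?_
    simp [Function.HasUncurry.uncurry, Finset.mul_sum]
    rw [add_comm, ← Finset.sum_neg_distrib]
    congr 1
    refine Finset.sum_congr rfl fun i _ => ?_
    ring
  · filter_upwards [hev y] with v hv
    refine (hdiff1 v.1 v.2 (Set.Ioo_subset_Icc_self hv)).hasFDerivAt.congr_fderiv ?_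
    ext w
    rw [apply_eq_sum_single]
    simp [Function.HasUncurry.uncurry, pdx, mul_comm]
  · filter_upwards [hev y] with v hv
    exact ((hdt v.1 v.2 (Set.Ioo_subset_Icc_self hv)).hasDerivAt
      (Icc_mem_nhds hv.1 hv.2)).hasFDerivAt
  · change ContinuousAt (fun v : EuclideanSpace ℝ (Fin n) × ℝ => ∑ i, pdx i u v.1 v.2 •
      (EuclideanSpace.proj i : EuclideanSpace ℝ (Fin n) →L[ℝ] ℝ)) (y, s)
    refine tendsto_finsetSum _ fun i _ => ?_
    exact ((hcont1 i).continuousAt (hnhds y)).smul continuousAt_const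
  · exact (ContinuousLinearMap.toSpanSingletonCLE (𝕜 := ℝ) (E := ℝ)).continuous.continuousAt.comp
      (hcontt.continuousAt (hnhds y))

theorem hasDerivAt_integral_heatK_one_mul (hμ : 0 < μ)
    (hcont : ContinuousOn (fun z : EuclideanSpace ℝ (Fin n) × ℝ => u z.1 z.2)
      (Set.univ ×ˢ Set.Icc (0 : ℝ) T))
    (hcontt : ContinuousOn (fun z : EuclideanSpace ℝ (Fin n) × ℝ => ut z.1 z.2)
      (Set.univ ×ˢ Set.Icc (0 : ℝ) T))
    (hcont1 : ∀ i : Fin n,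
      ContinuousOn (fun z : EuclideanSpace ℝ (Fin n) × ℝ => pdx i u z.1 z.2)
        (Set.univ ×ˢ Set.Icc (0 : ℝ) T))
    (hcont2 : ∀ i : Fin n,
      ContinuousOn (fun z : EuclideanSpace ℝ (Fin n) × ℝ => pdx i (pdx i u) z.1 z.2)
        (Set.univ ×ˢ Set.Icc (0 : ℝ) T))
    (hdt : ∀ (x : EuclideanSpace ℝ (Fin n)) (t : ℝ), t ∈ Set.Icc (0 : ℝ) T →
      HasDerivWithinAt (u x) (ut x t) (Set.Icc (0 : ℝ) T) t)
    (hdiff1 : ∀ (x : EuclideanSpace ℝ (Fin n)) (t : ℝ), t ∈ Set.Icc (0 : ℝ) T →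
      DifferentiableAt ℝ (fun y => u y t) x)
    (hdiff2 : ∀ (i : Fin n) (x : EuclideanSpace ℝ (Fin n)) (t : ℝ), t ∈ Set.Icc (0 : ℝ) T →
      DifferentiableAt ℝ (fun y => pdx i u y t) x)
    (hb0 : ∀ x, ∀ t ∈ Set.Icc (0 : ℝ) T, |u x t| ≤ C)
    (hb1 : ∀ (i : Fin n) x, ∀ t ∈ Set.Icc (0 : ℝ) T, |pdx i u x t| ≤ C)
    (hb2 : ∀ (i : Fin n) x, ∀ t ∈ Set.Icc (0 : ℝ) T, |pdx i (pdx i u) x t| ≤ C)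
    (hbt : ∀ x, ∀ t ∈ Set.Icc (0 : ℝ) T, |ut x t| ≤ C)
    (x : EuclideanSpace ℝ (Fin n)) {s t : ℝ} (ht : t ≤ T) (hs : s ∈ Set.Ioo 0 t) :
    HasDerivAt (fun s => ∫ z, heatK n μ z 1 * u (x - Real.sqrt (t - s) • z) s)
      (∫ z, heatK n μ z 1 * (ut (x - Real.sqrt (t - s) • z) s
        - μ * ∑ i, pdx i (pdx i u) (x - Real.sqrt (t - s) • z) s)) s := by
  have hsub : Set.Ioo 0 t ⊆ Set.Icc 0 T := fun r hr => ⟨hr.1.le, hr.2.le.trans ht⟩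
  have hγ := continuous_heatK_one n μ
  have hγi := integrable_heatK_one n hμ
  have hst : 0 < t - s := sub_pos.2 hs.2
  have hr : 0 < Real.sqrt (t - s) := Real.sqrt_pos.2 hst
  have hc : 0 < Real.sqrt ((t - s) / 2) := Real.sqrt_pos.2 (by linarith)
  have hC : 0 ≤ C := (abs_nonneg _).trans (hb0 x s (hsub hs))
  have hcomp : ∀ {f : EuclideanSpace ℝ (Fin n) → ℝ → ℝ},
      ContinuousOn (fun z : EuclideanSpace ℝ (Fin n) × ℝ => f z.1 z.2)
        (Set.univ ×ˢ Set.Icc (0 : ℝ) T) → ∀ r ∈ Set.Ioo 0 t,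
      Continuous fun z => f (x - Real.sqrt (t - r) • z) r := fun hf r hr =>
    (continuous_slice hf (hsub hr)).comp (by fun_prop)
  have hcompInt : ∀ {f : EuclideanSpace ℝ (Fin n) → ℝ → ℝ},
      ContinuousOn (fun z : EuclideanSpace ℝ (Fin n) × ℝ => f z.1 z.2)
        (Set.univ ×ˢ Set.Icc (0 : ℝ) T) → (∀ x, ∀ t ∈ Set.Icc (0 : ℝ) T, |f x t| ≤ C) →
      Integrable fun z => heatK n μ z 1 * f (x - Real.sqrt (t - s) • z) s := fun hf hb =>
    hγi.mul_bdd (c := C) (hcomp hf s hs).aestronglyMeasurable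
      (.of_forall fun z => hb _ s (hsub hs))
  have hcoordint : ∀ i, Integrable fun z : EuclideanSpace ℝ (Fin n) =>
      heatK n μ z 1 * (z i * pdx i u (x - Real.sqrt (t - s) • z) s) := by
    intro i
    refine ((integrable_heatK_one_mul_norm n hμ).mul_const C).mono'
      (hγ.mul (Continuous.mul (by fun_prop) (hcomp (hcont1 i) s hs))).aestronglyMeasurable
      (.of_forall fun z => ?_)
    rw [norm_mul, norm_mul, Real.norm_of_nonneg (heatK_nonneg hμ one_pos z), mul_assoc]
    exact mul_le_mul_of_nonneg_left (mul_le_mul (PiLp.norm_apply_le z i) (hb1 i _ s (hsub hs))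
      (norm_nonneg _) (norm_nonneg _)) (heatK_nonneg hμ one_pos z)
  have hnhds : Set.Ioo 0 ((s + t) / 2) ∈ nhds s :=
    Ioo_mem_nhds hs.1 (by linarith)
  have hlt : ∀ r ∈ Set.Ioo 0 ((s + t) / 2), r ∈ Set.Ioo 0 t := fun r hr =>
    ⟨hr.1, by linarith [hr.2]⟩
  have key := (hasDerivAt_integral_of_dominated_loc_of_deriv_le (μ := volume) (x₀ := s)
    (F := fun s z => heatK n μ z 1 * u (x - Real.sqrt (t - s) • z) s)
    (F' := fun s z => heatK n μ z 1 * (ut (x - Real.sqrt (t - s) • z) s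
      + 1 / (2 * Real.sqrt (t - s)) * ∑ i, z i * pdx i u (x - Real.sqrt (t - s) • z) s))
    (bound := fun z => heatK n μ z 1 * C
      + heatK n μ z 1 * ‖z‖ * (1 / (2 * Real.sqrt ((t - s) / 2)) * (n * C)))
    hnhds ?_ (hcompInt hcont hb0) ?_ (.of_forall fun z r hr => ?_)
    ((hγi.mul_const C).add ((integrable_heatK_one_mul_norm n hμ).mul_const _))
    (.of_forall fun z r hr => ?_)).2
  · refine key.congr_deriv ?_
    have hibp : ∀ i : Fin n,
        ∫ z, heatK n μ z 1 * (z i * pdx i u (x - Real.sqrt (t - s) • z) s)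
        = -(2 * μ * Real.sqrt (t - s))
          * ∫ z, heatK n μ z 1 * pdx i (pdx i u) (x - Real.sqrt (t - s) • z) s := fun i =>
      integral_heatK_one_mul_coord_mul hμ i (g := fun y => pdx i u y s)
        (fun y => hdiff2 i y s (hsub hs)) (continuous_slice (hcont2 i) (hsub hs))
        (fun y => hb1 i y s (hsub hs)) (fun y => hb2 i y s (hsub hs)) x _
    calc _ = ∫ z, (heatK n μ z 1 * ut (x - Real.sqrt (t - s) • z) s
          + 1 / (2 * Real.sqrt (t - s))
            * ∑ i, heatK n μ z 1 * (z i * pdx i u (x - Real.sqrt (t - s) • z) s)) := by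
          simp only [← Finset.mul_sum]
          congr 1 with z
          ring
      _ = (∫ z, heatK n μ z 1 * ut (x - Real.sqrt (t - s) • z) s)
          - μ * ∑ i, ∫ z, heatK n μ z 1 * pdx i (pdx i u) (x - Real.sqrt (t - s) • z) s := by
          rw [integral_add (hcompInt hcontt hbt)
            ((integrable_finsetSum _ fun i _ => hcoordint i).const_mul _),
            integral_const_mul, integral_finsetSum _ fun i _ => hcoordint i]
          simp only [hibp, ← Finset.mul_sum]
          field_simp
          ring
      _ = ∫ z, (heatK n μ z 1 * ut (x - Real.sqrt (t - s) • z) s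
          - μ * ∑ i, heatK n μ z 1 * pdx i (pdx i u) (x - Real.sqrt (t - s) • z) s) := by
          rw [integral_sub (hcompInt hcontt hbt)
            ((integrable_finsetSum _ fun i _ => hcompInt (hcont2 i) (hb2 i)).const_mul _),
            integral_const_mul, integral_finsetSum _ fun i _ => hcompInt (hcont2 i) (hb2 i)]
      _ = _ := by
          simp only [← Finset.mul_sum]
          congr 1 with z
          ring
  · filter_upwards [hnhds] with r hr
    exact (hγ.mul (hcomp hcont r (hlt r hr))).aestronglyMeasurable
  · exact (hγ.mul ((hcomp hcontt s hs).add (continuous_const.mul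
      (continuous_finsetSum _ fun i _ =>
        Continuous.mul (by fun_prop) (hcomp (hcont1 i) s hs))))).aestronglyMeasurable
  · have hrt := hlt r hr
    rw [norm_mul, Real.norm_of_nonneg (heatK_nonneg hμ one_pos z), mul_assoc, ← mul_add]
    refine mul_le_mul_of_nonneg_left ?_ (heatK_nonneg hμ one_pos z)
    refine (norm_add_le _ _).trans (add_le_add (hbt _ r (hsub hrt)) ?_)
    rw [norm_mul, Real.norm_of_nonneg (by positivity)]
    have h1 : Real.sqrt ((t - s) / 2) ≤ Real.sqrt (t - r) :=
      Real.sqrt_le_sqrt (by linarith [hr.2])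
    have h2 : ‖∑ i, z i * pdx i u (x - Real.sqrt (t - r) • z) r‖ ≤ ‖z‖ * (n * C) := by
      refine (norm_sum_le_of_le (f := fun i => z i * pdx i u (x - Real.sqrt (t - r) • z) r)
        Finset.univ (n := fun _ => ‖z‖ * C) fun i _ => ?_).trans_eq ?_
      · rw [norm_mul]
        exact mul_le_mul (PiLp.norm_apply_le z i) (hb1 i _ r (hsub hrt))
          (norm_nonneg _) (norm_nonneg _)
      · simp
        ring
    calc _ ≤ 1 / (2 * Real.sqrt ((t - s) / 2)) * (‖z‖ * (n * C)) := by gcongr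
      _ = _ := by ring
  · exact (hasDerivAt_comp_sub_sqrt_smul hcontt hcont1 hdt hdiff1 x z ht (hlt r hr)).const_mul _

end SpaceTime

/-- the Green-type representation
`u(x,t) = ∫₀^t ∫ ψ_μ(x−y,t−s)(∂_t u − μΔu)(y,s) dy ds + ∫ ψ_μ(x−y,t) u(y,0) dy`
for functions with the weighted bounds `|u| ≤ Mw^{−δ}`, `|∂_i u| ≤ Mw^{−δ−1}`,
`|∂_i∂_j u| ≤ Mw^{−δ−2}`, `|∂_t u| ≤ Mw^{−δ}` on `ℝⁿ × [0,T]`, `δ > 0`. -/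
theorem statement17 (n : ℕ) (hn : 2 ≤ n) (μ T δ : ℝ) (hμ : 0 < μ) (hT : 0 < T) (hδ : 0 < δ)
    (u ut : EuclideanSpace ℝ (Fin n) → ℝ → ℝ) (M : ℝ)
    -- continuity of `u`, `∂_t u`, and the spatial derivatives up to order two on `ℝⁿ × [0,T]`
    (hcont : ContinuousOn (fun z : EuclideanSpace ℝ (Fin n) × ℝ => u z.1 z.2)
      (Set.univ ×ˢ Set.Icc (0 : ℝ) T))
    (hcontt : ContinuousOn (fun z : EuclideanSpace ℝ (Fin n) × ℝ => ut z.1 z.2)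
      (Set.univ ×ˢ Set.Icc (0 : ℝ) T))
    (hcont1 : ∀ i : Fin n,
      ContinuousOn (fun z : EuclideanSpace ℝ (Fin n) × ℝ => pdx i u z.1 z.2)
        (Set.univ ×ˢ Set.Icc (0 : ℝ) T))
    (hcont2 : ∀ i j : Fin n,
      ContinuousOn (fun z : EuclideanSpace ℝ (Fin n) × ℝ => pdx j (pdx i u) z.1 z.2)
        (Set.univ ×ˢ Set.Icc (0 : ℝ) T))
    -- existence of the derivatives
    (hdt : ∀ (x : EuclideanSpace ℝ (Fin n)) (t : ℝ), t ∈ Set.Icc (0 : ℝ) T →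
      HasDerivWithinAt (u x) (ut x t) (Set.Icc (0 : ℝ) T) t)
    (hdiff1 : ∀ (x : EuclideanSpace ℝ (Fin n)) (t : ℝ), t ∈ Set.Icc (0 : ℝ) T →
      DifferentiableAt ℝ (fun y => u y t) x)
    (hdiff2 : ∀ (i : Fin n) (x : EuclideanSpace ℝ (Fin n)) (t : ℝ), t ∈ Set.Icc (0 : ℝ) T →
      DifferentiableAt ℝ (fun y => pdx i u y t) x)
    -- the weighted bounds
    (hb0 : ∀ x t, t ∈ Set.Icc (0 : ℝ) T → |u x t| ≤ M * wgt x ^ (-δ))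
    (hb1 : ∀ (i : Fin n) x t, t ∈ Set.Icc (0 : ℝ) T → |pdx i u x t| ≤ M * wgt x ^ (-δ - 1))
    (hb2 : ∀ (i j : Fin n) x t, t ∈ Set.Icc (0 : ℝ) T →
      |pdx j (pdx i u) x t| ≤ M * wgt x ^ (-δ - 2))
    (hbt : ∀ x t, t ∈ Set.Icc (0 : ℝ) T → |ut x t| ≤ M * wgt x ^ (-δ)) :
    ∀ (x : EuclideanSpace ℝ (Fin n)) (t : ℝ), 0 < t → t ≤ T →
      u x t =
        (∫ s in (0 : ℝ)..t, ∫ y : EuclideanSpace ℝ (Fin n),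
            heatK n μ (x - y) (t - s) * (ut y s - μ * ∑ i, pdx i (pdx i u) y s))
        + ∫ y : EuclideanSpace ℝ (Fin n), heatK n μ (x - y) t * u y 0 := by
  intro x t ht htT
  have hwgt : ∀ y : EuclideanSpace ℝ (Fin n), 1 ≤ wgt y := fun y =>
    Real.one_le_sqrt.2 (by nlinarith [sq_nonneg ‖y‖])
  have hM : 0 ≤ M := by
    have h := (abs_nonneg _).trans (hb0 0 0 ⟨le_rfl, hT.le⟩)
    exact nonneg_of_mul_nonneg_left h (Real.rpow_pos_of_pos (one_pos.trans_le (hwgt 0)) _)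
  have hle : ∀ (y : EuclideanSpace ℝ (Fin n)) {a : ℝ}, a ≤ 0 → M * wgt y ^ a ≤ M :=
    fun y a ha => mul_le_of_le_one_right hM (Real.rpow_le_one_of_one_le_of_nonpos (hwgt y) ha)
  have hB0 : ∀ y, ∀ s ∈ Set.Icc (0 : ℝ) T, |u y s| ≤ M := fun y s hs =>
    (hb0 y s hs).trans (hle y (by linarith))
  have hB1 : ∀ (i : Fin n) y, ∀ s ∈ Set.Icc (0 : ℝ) T, |pdx i u y s| ≤ M := fun i y s hs =>
    (hb1 i y s hs).trans (hle y (by linarith))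
  have hB2 : ∀ (i : Fin n) y, ∀ s ∈ Set.Icc (0 : ℝ) T, |pdx i (pdx i u) y s| ≤ M :=
    fun i y s hs => (hb2 i i y s hs).trans (hle y (by linarith))
  have hBt : ∀ y, ∀ s ∈ Set.Icc (0 : ℝ) T, |ut y s| ≤ M := fun y s hs =>
    (hbt y s hs).trans (hle y (by linarith))
  have hBg : ∀ y, ∀ s ∈ Set.Icc (0 : ℝ) T,
      |ut y s - μ * ∑ i, pdx i (pdx i u) y s| ≤ M + μ * (n * M) := by
    intro y s hs
    refine (abs_sub _ _).trans (add_le_add (hBt y s hs) ?_)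
    rw [abs_mul, abs_of_pos hμ]
    refine mul_le_mul_of_nonneg_left ((Finset.abs_sum_le_sum_abs _ _).trans ?_) hμ.le
    refine (Finset.sum_le_sum fun i _ => hB2 i y s hs).trans_eq ?_
    simp
  have hcontg : ContinuousOn (fun z : EuclideanSpace ℝ (Fin n) × ℝ =>
      ut z.1 z.2 - μ * ∑ i, pdx i (pdx i u) z.1 z.2) (Set.univ ×ˢ Set.Icc (0 : ℝ) T) :=
    hcontt.sub (continuousOn_const.mul (continuousOn_finsetSum _ fun i _ => hcont2 i i))
  have hftc := intervalIntegral.integral_eq_sub_of_hasDerivAt_of_le ht.le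
    (continuousOn_integral_heatK_one_mul hμ hcont hB0 x htT)
    (fun s hs => hasDerivAt_integral_heatK_one_mul hμ hcont hcontt hcont1
      (fun i => hcont2 i i) hdt hdiff1 hdiff2 hB0 hB1 hB2 hBt x htT hs)
    ((continuousOn_integral_heatK_one_mul hμ
      (f := fun y s => ut y s - μ * ∑ i, pdx i (pdx i u) y s) hcontg hBg x
      htT).intervalIntegrable_of_Icc ht.le)
  have hduhamel : (∫ s in (0 : ℝ)..t, ∫ y : EuclideanSpace ℝ (Fin n),
        heatK n μ (x - y) (t - s) * (ut y s - μ * ∑ i, pdx i (pdx i u) y s))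
      = ∫ s in (0 : ℝ)..t, ∫ z, heatK n μ z 1 * (ut (x - Real.sqrt (t - s) • z) s
        - μ * ∑ i, pdx i (pdx i u) (x - Real.sqrt (t - s) • z) s) := by
    refine intervalIntegral.integral_congr_ae ?_
    filter_upwards [Measure.ae_ne volume t] with s hst hs
    rw [Set.uIoc_of_le ht.le] at hs
    exact integral_heatK_sub_mul hμ (sub_pos.2 (lt_of_le_of_ne hs.2 hst))
      (fun y => ut y s - μ * ∑ i, pdx i (pdx i u) y s) x
  rw [hduhamel, hftc, integral_heatK_sub_mul hμ ht (fun y => u y 0)]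
  simp [integral_mul_const, integral_heatK_one n hμ]
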